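/- arXiv:2110.04145 — 2 statements merged into one kernel-verified Lean document; each statement's English description precedes it below -/
import Mathlib

section
/- Let F be a nonempty closed set in ℝⁿ (n ≥ 2) with distance function δ(x) = dist(x, F). Then there exists a function Δ : Fᶜ → ℝ that is C^∞ (infinitely differentiable) on Fᶜ and constants c₁, c₂ > 0 (independent of F) such that c₁ δ(x) ≤ Δ(x) ≤ c₂ δ(x) for all x ∈ Fᶜ, and for every multi-index α there is a constant B_α (independent of F) with |∂^α Δ(x)| ≤ B_α δ(x)^{1−|α|} for all x ∈ Fᶜ. -/
section RegularizedDistance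

open MeasureTheory Metric Set Module

universe u v

lemma infDist_pos_of_mem_compl {X : Type*} [PseudoMetricSpace X] {F : Set X} (hF : IsClosed F)
    (hne : F.Nonempty) {x : X} (hx : x ∈ Fᶜ) : 0 < infDist x F :=
  (hF.notMem_iff_infDist_pos hne).1 hx

lemma exists_norm_bound_of_tsupport_subset {X Y : Type*} [PseudoMetricSpace X] [Zero X]
    [ProperSpace X] [SeminormedAddCommGroup Y] {φ : X → Y} (hc : Continuous φ) {r : ℝ}
    (hφ : tsupport φ ⊆ closedBall 0 r) : ∃ M, ∀ z, ‖φ z‖ ≤ M :=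
  HasCompactSupport.exists_bound_of_continuous
    ((isCompact_closedBall 0 r).of_isClosed_subset (isClosed_tsupport φ) hφ) hc

variable {E : Type u} [NormedAddCommGroup E] [NormedSpace ℝ E]
  {G : Type v} [NormedAddCommGroup G] [NormedSpace ℝ G]

/-- The bump `φ`, rescaled to be centred at `y` with width comparable to `dist(y, F)`, and
weighted by the power `dist(y, F) ^ a`. -/
noncomputable def distKernel (F : Set E) (a : ℝ) (φ : E → G) (x y : E) : G :=
  infDist y F ^ a • φ ((infDist y F)⁻¹ • (x - y))

/-- The superposition over all centres `y` of the bumps `distKernel F a φ · y`. -/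
noncomputable def distIntegral [MeasurableSpace E] (μ : Measure E) (F : Set E) (a : ℝ)
    (φ : E → G) (x : E) : G :=
  ∫ y, distKernel F a φ x y ∂μ

lemma distKernel_eq_zero_of_infDist_eq_zero {F : Set E} {a : ℝ} (ha : a < 0) (φ : E → G)
    (x : E) {y : E} (hy : infDist y F = 0) : distKernel F a φ x y = 0 := by
  simp [distKernel, hy, Real.zero_rpow ha.ne]

lemma infDist_pos_and_dist_le_of_distKernel_ne_zero {F : Set E} {a : ℝ} (ha : a < 0) {φ : E → G}
    (hφ : tsupport φ ⊆ closedBall 0 (1 / 2)) {x y : E} (h : distKernel F a φ x y ≠ 0) :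
    0 < infDist y F ∧ dist x y ≤ infDist y F / 2 := by
  have hpos : 0 < infDist y F := by
    refine lt_of_le_of_ne infDist_nonneg fun h0 => h ?_
    exact distKernel_eq_zero_of_infDist_eq_zero ha φ x h0.symm
  refine ⟨hpos, ?_⟩
  have h1 : φ ((infDist y F)⁻¹ • (x - y)) ≠ 0 := fun h0 => h (by simp [distKernel, h0])
  have h2 := hφ (subset_tsupport φ h1)
  rw [mem_closedBall_zero_iff, norm_smul, norm_inv, Real.norm_of_nonneg hpos.le,
    inv_mul_le_iff₀ hpos] at h2
  rw [dist_eq_norm]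
  linarith

/-- Near `x₀` the kernel is bounded uniformly in `x`, and supported in a ball about `x₀`. -/
lemma norm_distKernel_le_indicator {F : Set E} {a : ℝ} (ha : a < 0) {φ : E → G}
    (hφ : tsupport φ ⊆ closedBall 0 (1 / 2)) {M : ℝ} (hM : ∀ z, ‖φ z‖ ≤ M) {x₀ x : E}
    (h₀ : 0 < infDist x₀ F) (hx : x ∈ ball x₀ (infDist x₀ F / 4)) (y : E) :
    ‖distKernel F a φ x y‖ ≤ (closedBall x₀ (2 * infDist x₀ F)).indicator
      (fun _ => (infDist x₀ F / 2) ^ a * M) y := by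
  have hM0 : 0 ≤ M := (norm_nonneg _).trans (hM 0)
  by_cases h : distKernel F a φ x y = 0
  · rw [h, norm_zero]
    exact indicator_nonneg (fun _ _ => by positivity) y
  obtain ⟨hpos, hd⟩ := infDist_pos_and_dist_le_of_distKernel_ne_zero ha hφ h
  rw [mem_ball] at hx
  have h1 : infDist x₀ F ≤ infDist x F + dist x₀ x := infDist_le_infDist_add_dist
  have h2 : infDist x F ≤ infDist x₀ F + dist x x₀ := infDist_le_infDist_add_dist
  have h3 : infDist x F ≤ infDist y F + dist x y := infDist_le_infDist_add_dist
  have h4 : infDist y F ≤ infDist x F + dist y x := infDist_le_infDist_add_dist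
  have h5 : dist y x₀ ≤ dist y x + dist x x₀ := dist_triangle _ _ _
  rw [dist_comm x₀ x] at h1
  rw [dist_comm y x] at h4 h5
  have hmem : y ∈ closedBall x₀ (2 * infDist x₀ F) := by
    rw [mem_closedBall]; linarith
  rw [indicator_of_mem hmem, distKernel, norm_smul, Real.norm_of_nonneg (by positivity)]
  exact mul_le_mul (Real.rpow_le_rpow_of_nonpos (by positivity) (by linarith) ha.le) (hM _)
    (norm_nonneg _) (by positivity)

/-- Differentiating the kernel differentiates the bump and lowers the weight by one power. -/
lemma hasFDerivAt_distKernel {F : Set E} {a : ℝ} (ha : a < 0) {φ : E → G}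
    (hd : Differentiable ℝ φ) (x y : E) :
    HasFDerivAt (distKernel F a φ · y) (distKernel F (a - 1) (fderiv ℝ φ) x y) x := by
  rcases (infDist_nonneg (x := y) (s := F)).eq_or_lt with h0 | hpos
  · have h1 : distKernel F (a - 1) (fderiv ℝ φ) x y = 0 :=
      distKernel_eq_zero_of_infDist_eq_zero (by linarith) _ _ h0.symm
    have h2 : (distKernel F a φ · y) = fun _ => 0 :=
      funext fun _ => distKernel_eq_zero_of_infDist_eq_zero ha _ _ h0.symm
    rw [h1, h2]
    exact hasFDerivAt_const _ _
  · have h1 : HasFDerivAt (fun x : E => (infDist y F)⁻¹ • (x - y))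
        ((infDist y F)⁻¹ • ContinuousLinearMap.id ℝ E) x :=
      ((hasFDerivAt_id x).sub_const y).const_smul _
    have h2 := ((hd ((infDist y F)⁻¹ • (x - y))).hasFDerivAt.comp x h1).const_smul
      (infDist y F ^ a)
    refine h2.congr_fderiv ?_
    rw [distKernel, ContinuousLinearMap.comp_smul, ContinuousLinearMap.comp_id, smul_smul,
      Real.rpow_sub_one hpos.ne', div_eq_mul_inv]

variable [FiniteDimensional ℝ E] [MeasurableSpace E] [BorelSpace E]

lemma stronglyMeasurable_distKernel (F : Set E) (a : ℝ) {φ : E → G} (hφ : Continuous φ) (x : E) :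
    StronglyMeasurable (distKernel F a φ x) := by
  have h1 : Measurable fun y : E => infDist y F := measurable_infDist
  have h2 : StronglyMeasurable fun y : E => (infDist y F)⁻¹ • (x - y) :=
    (h1.inv.smul (measurable_const.sub measurable_id)).stronglyMeasurable
  exact (h1.pow_const a).stronglyMeasurable.smul (hφ.comp_stronglyMeasurable h2)

variable (μ : Measure E) [μ.IsAddHaarMeasure]

lemma integrable_indicator_closedBall (x : E) (r c : ℝ) :
    Integrable ((closedBall x r).indicator fun _ => c) μ :=
  (integrable_indicator_iff measurableSet_closedBall).2
    (integrableOn_const measure_closedBall_lt_top.ne)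

lemma integrable_distKernel {F : Set E} {a : ℝ} (ha : a < 0) {φ : E → G}
    (hφ : tsupport φ ⊆ closedBall 0 (1 / 2)) (hc : Continuous φ) {M : ℝ}
    (hM : ∀ z, ‖φ z‖ ≤ M) {x : E} (hx : 0 < infDist x F) :
    Integrable (distKernel F a φ x) μ :=
  (integrable_indicator_closedBall μ _ _ _).mono'
    (stronglyMeasurable_distKernel F a hc x).aestronglyMeasurable
    (.of_forall fun y => norm_distKernel_le_indicator ha hφ hM hx
      (mem_ball_self (by positivity)) y)

lemma norm_distIntegral_le {F : Set E} {a : ℝ} (ha : a < 0) {φ : E → G}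
    (hφ : tsupport φ ⊆ closedBall 0 (1 / 2)) {M : ℝ} (hM : ∀ z, ‖φ z‖ ≤ M) {x : E}
    (hx : 0 < infDist x F) :
    ‖distIntegral μ F a φ x‖ ≤
      ((2⁻¹ : ℝ) ^ a * M * 2 ^ finrank ℝ E * μ.real (closedBall 0 1)) *
        infDist x F ^ (a + finrank ℝ E) := by
  refine (norm_integral_le_of_norm_le (integrable_indicator_closedBall μ _ _ _)
    (.of_forall fun y => norm_distKernel_le_indicator ha hφ hM hx
      (mem_ball_self (by positivity)) y)).trans_eq ?_
  rw [integral_indicator_const _ measurableSet_closedBall,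
    Measure.addHaar_real_closedBall' μ _ (by positivity), Real.rpow_add hx, Real.rpow_natCast,
    div_eq_mul_inv, Real.mul_rpow hx.le (by positivity), mul_pow, smul_eq_mul]
  ring

lemma hasFDerivAt_distIntegral {F : Set E} {a : ℝ} (ha : a < 0) {φ : E → G}
    (hφ : tsupport φ ⊆ closedBall 0 (1 / 2)) (hs : ContDiff ℝ (⊤ : ℕ∞) φ) {x : E}
    (hx : 0 < infDist x F) :
    HasFDerivAt (distIntegral μ F a φ) (distIntegral μ F (a - 1) (fderiv ℝ φ) x) x := by
  have hφ' : tsupport (fderiv ℝ φ) ⊆ closedBall 0 (1 / 2) := (tsupport_fderiv_subset ℝ).trans hφ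
  have hc' : Continuous (fderiv ℝ φ) := (contDiff_infty_iff_fderiv.1 hs).2.continuous
  obtain ⟨M, hM⟩ := exists_norm_bound_of_tsupport_subset hs.continuous hφ
  obtain ⟨M', hM'⟩ := exists_norm_bound_of_tsupport_subset hc' hφ'
  exact hasFDerivAt_integral_of_dominated_of_fderiv_le
    (ball_mem_nhds x (by positivity : 0 < infDist x F / 4))
    (.of_forall fun z => (stronglyMeasurable_distKernel F a hs.continuous z).aestronglyMeasurable)
    (integrable_distKernel μ ha hφ hs.continuous hM hx)
    (stronglyMeasurable_distKernel F (a - 1) hc' x).aestronglyMeasurable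
    (.of_forall fun y z hz => norm_distKernel_le_indicator (by linarith) hφ' hM' hx hz y)
    (integrable_indicator_closedBall μ _ _ _)
    (.of_forall fun y z _ => hasFDerivAt_distKernel ha (contDiff_infty_iff_fderiv.1 hs).1 z y)

/-- Smoothness of `distIntegral`. -/
lemma contDiffOn_distIntegral (m : ℕ) {F : Set E} (hF : IsClosed F) (hne : F.Nonempty) :
    ∀ {G : Type u} [NormedAddCommGroup G] [NormedSpace ℝ G] {a : ℝ} (_ : a < 0) {φ : E → G}
      (_ : tsupport φ ⊆ closedBall 0 (1 / 2)) (_ : ContDiff ℝ (⊤ : ℕ∞) φ),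
      ContDiffOn ℝ m (distIntegral μ F a φ) Fᶜ := by
  induction m with
  | zero =>
    intro G _ _ a ha φ hφ hs
    refine contDiffOn_zero.2 fun x hx => ContinuousAt.continuousWithinAt ?_
    exact (hasFDerivAt_distIntegral μ ha hφ hs (infDist_pos_of_mem_compl hF hne hx)).continuousAt
  | succ m ih =>
    intro G _ _ a ha φ hφ hs
    have hs' : ContDiff ℝ (⊤ : ℕ∞) (fderiv ℝ φ) := (contDiff_infty_iff_fderiv.1 hs).2
    have hφ' : tsupport (fderiv ℝ φ) ⊆ closedBall 0 (1 / 2) :=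
      (tsupport_fderiv_subset ℝ).trans hφ
    have hd : ∀ x ∈ Fᶜ, HasFDerivAt (distIntegral μ F a φ)
        (distIntegral μ F (a - 1) (fderiv ℝ φ) x) x := fun x hx =>
      hasFDerivAt_distIntegral μ ha hφ hs (infDist_pos_of_mem_compl hF hne hx)
    rw [Nat.cast_add, Nat.cast_one, contDiffOn_succ_iff_fderiv_of_isOpen hF.isOpen_compl]
    refine ⟨fun x hx => (hd x hx).differentiableAt.differentiableWithinAt, by simp, ?_⟩
    exact (ih (sub_one_lt a |>.trans ha) hφ' hs').congr fun x hx => (hd x hx).fderiv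

/-- Derivative estimates for `distIntegral`, uniform in the closed set. -/
lemma exists_norm_iteratedFDerivWithin_distIntegral_le (m : ℕ) :
    ∀ {G : Type u} [NormedAddCommGroup G] [NormedSpace ℝ G] {a : ℝ} (_ : a < 0) {φ : E → G}
      (_ : tsupport φ ⊆ closedBall 0 (1 / 2)) (_ : ContDiff ℝ (⊤ : ℕ∞) φ),
      ∃ B : ℝ, ∀ F : Set E, IsClosed F → F.Nonempty → ∀ x ∈ Fᶜ,
        ‖iteratedFDerivWithin ℝ m (distIntegral μ F a φ) Fᶜ x‖ ≤
          B * infDist x F ^ (a + finrank ℝ E - m) := by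
  induction m with
  | zero =>
    intro G _ _ a ha φ hφ hs
    obtain ⟨M, hM⟩ := exists_norm_bound_of_tsupport_subset hs.continuous hφ
    refine ⟨(2⁻¹ : ℝ) ^ a * M * 2 ^ finrank ℝ E * μ.real (closedBall 0 1),
      fun F hF hne x hx => ?_⟩
    rw [norm_iteratedFDerivWithin_zero, Nat.cast_zero, sub_zero]
    exact norm_distIntegral_le μ ha hφ hM (infDist_pos_of_mem_compl hF hne hx)
  | succ m ih =>
    intro G _ _ a ha φ hφ hs
    have hs' : ContDiff ℝ (⊤ : ℕ∞) (fderiv ℝ φ) := (contDiff_infty_iff_fderiv.1 hs).2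
    have hφ' : tsupport (fderiv ℝ φ) ⊆ closedBall 0 (1 / 2) :=
      (tsupport_fderiv_subset ℝ).trans hφ
    obtain ⟨B, hB⟩ := ih (sub_one_lt a |>.trans ha) hφ' hs'
    refine ⟨B, fun F hF hne x hx => ?_⟩
    have hu : UniqueDiffOn ℝ Fᶜ := hF.isOpen_compl.uniqueDiffOn
    have hd : EqOn (fderivWithin ℝ (distIntegral μ F a φ) Fᶜ)
        (distIntegral μ F (a - 1) (fderiv ℝ φ)) Fᶜ := fun z hz =>
      (hasFDerivAt_distIntegral μ ha hφ hs (infDist_pos_of_mem_compl hF hne hz)).hasFDerivWithinAt.fderivWithin (hu z hz)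
    rw [← norm_iteratedFDerivWithin_fderivWithin hu hx, iteratedFDerivWithin_congr hd hx]
    convert hB F hF hne x hx using 3
    push_cast
    ring

/-- A nonnegative bump which is `1` on the ball of radius `1 / 4` has `distIntegral`
bounded below. -/
lemma le_distIntegral {F : Set E} {a : ℝ} (ha : a < 0) {φ : E → ℝ}
    (hφ : tsupport φ ⊆ closedBall 0 (1 / 2)) (hc : Continuous φ) (h0 : ∀ z, 0 ≤ φ z)
    (h1 : ∀ z ∈ closedBall 0 (1 / 4), φ z = 1) {x : E} (hx : 0 < infDist x F) :
    ((2 : ℝ) ^ a * 5⁻¹ ^ finrank ℝ E * μ.real (closedBall 0 1)) *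
      infDist x F ^ (a + finrank ℝ E) ≤ distIntegral μ F a φ x := by
  obtain ⟨M, hM⟩ := exists_norm_bound_of_tsupport_subset hc hφ
  have hle : ∫ y, (closedBall x (infDist x F * 5⁻¹)).indicator
      (fun _ => (infDist x F * 2) ^ a) y ∂μ ≤ distIntegral μ F a φ x := by
    refine integral_mono (integrable_indicator_closedBall μ _ _ _)
      (integrable_distKernel μ ha hφ hc hM hx) fun y => ?_
    refine indicator_le' (fun y hy => ?_) (fun y _ => ?_) y
    · rw [mem_closedBall] at hy
      have h2 : infDist x F ≤ infDist y F + dist x y := infDist_le_infDist_add_dist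
      have h3 : infDist y F ≤ infDist x F + dist y x := infDist_le_infDist_add_dist
      rw [dist_comm] at h2
      have hpos : 0 < infDist y F := by linarith
      have hone : φ ((infDist y F)⁻¹ • (x - y)) = 1 := by
        refine h1 _ ?_
        rw [mem_closedBall_zero_iff, norm_smul, norm_inv, Real.norm_of_nonneg hpos.le,
          inv_mul_le_iff₀ hpos, ← dist_eq_norm, dist_comm]
        linarith
      rw [distKernel, hone, smul_eq_mul, mul_one]
      exact Real.rpow_le_rpow_of_nonpos hpos (by linarith) ha.le
    · exact smul_nonneg (Real.rpow_nonneg infDist_nonneg a) (h0 _)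
  refine le_of_eq_of_le ?_ hle
  rw [integral_indicator_const _ measurableSet_closedBall,
    Measure.addHaar_real_closedBall' μ x (by positivity), Real.rpow_add hx, Real.rpow_natCast,
    Real.mul_rpow hx.le (by positivity), mul_pow, smul_eq_mul]
  ring

end RegularizedDistance

/-- Stein's regularized distance: for `n ≥ 2` there are constants `c₁, c₂ > 0` and,
for every derivative order `m`, a constant `B m` — all independent of `F` — such that
for every nonempty closed set `F ⊂ ℝⁿ` there is a function `Δ`, smooth on `Fᶜ`, with
`c₁ δ(x) ≤ Δ(x) ≤ c₂ δ(x)` and `‖D^m Δ(x)‖ ≤ B m · δ(x)^{1−m}` on `Fᶜ`,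
where `δ(x) = dist(x, F)`. -/
theorem stmt_5 (n : ℕ) (hn : 2 ≤ n) :
    ∃ c₁ c₂ : ℝ, 0 < c₁ ∧ 0 < c₂ ∧ ∃ B : ℕ → ℝ,
      ∀ F : Set (EuclideanSpace ℝ (Fin n)), IsClosed F → F.Nonempty →
        ∃ Δ : EuclideanSpace ℝ (Fin n) → ℝ,
          ContDiffOn ℝ (⊤ : ℕ∞) Δ Fᶜ ∧
          (∀ x ∈ Fᶜ, c₁ * Metric.infDist x F ≤ Δ x ∧ Δ x ≤ c₂ * Metric.infDist x F) ∧
          (∀ m : ℕ, ∀ x ∈ Fᶜ,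
            ‖iteratedFDerivWithin ℝ m Δ Fᶜ x‖ ≤ B m * (Metric.infDist x F) ^ ((1 : ℝ) - m)) := by
  have ha : (1 : ℝ) - n < 0 := by
    have : (2 : ℝ) ≤ n := by exact_mod_cast hn
    linarith
  have hexp : (1 : ℝ) - n + Module.finrank ℝ (EuclideanSpace ℝ (Fin n)) = 1 := by
    rw [finrank_euclideanSpace_fin]
    ring
  let φ : ContDiffBump (0 : EuclideanSpace ℝ (Fin n)) := ⟨1 / 4, 1 / 2, by norm_num, by norm_num⟩
  have hφ : tsupport φ ⊆ Metric.closedBall 0 (1 / 2) := φ.tsupport_eq.subset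
  have hvol : 0 < MeasureTheory.volume.real
      (Metric.closedBall (0 : EuclideanSpace ℝ (Fin n)) 1) :=
    ENNReal.toReal_pos (Metric.measure_closedBall_pos _ _ one_pos).ne'
      MeasureTheory.measure_closedBall_lt_top.ne
  choose B hB using fun m => exists_norm_iteratedFDerivWithin_distIntegral_le
    MeasureTheory.volume m ha hφ φ.contDiff
  refine ⟨(2 : ℝ) ^ ((1 : ℝ) - n) * 5⁻¹ ^ Module.finrank ℝ (EuclideanSpace ℝ (Fin n)) *
      MeasureTheory.volume.real (Metric.closedBall (0 : EuclideanSpace ℝ (Fin n)) 1),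
    (2⁻¹ : ℝ) ^ ((1 : ℝ) - n) * 1 * 2 ^ Module.finrank ℝ (EuclideanSpace ℝ (Fin n)) *
      MeasureTheory.volume.real (Metric.closedBall (0 : EuclideanSpace ℝ (Fin n)) 1),
    by positivity, by positivity, B, fun F hF hne =>
      ⟨distIntegral MeasureTheory.volume F (1 - n) φ, ?_, fun x hx => ⟨?_, ?_⟩,
        fun m x hx => ?_⟩⟩
  · exact contDiffOn_infty.2 fun m =>
      contDiffOn_distIntegral MeasureTheory.volume m hF hne ha hφ φ.contDiff
  · have := le_distIntegral MeasureTheory.volume ha hφ φ.continuous (fun _ => φ.nonneg)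
      (fun _ => φ.one_of_mem_closedBall) (infDist_pos_of_mem_compl hF hne hx)
    rwa [hexp, Real.rpow_one] at this
  · have := norm_distIntegral_le MeasureTheory.volume ha hφ (M := 1)
      (fun z => by rw [Real.norm_of_nonneg φ.nonneg]; exact φ.le_one)
      (infDist_pos_of_mem_compl hF hne hx)
    rw [hexp, Real.rpow_one] at this
    exact (Real.le_norm_self _).trans this
  · simpa only [hexp] using hB m F hF hne x hx
end

section
/- There exists a continuous function ψ : [1, ∞) → ℝ such that ψ(λ) = O(λ^{−N}) as λ → ∞ for every N ∈ ℕ, ∫₁^∞ ψ(λ) dλ = 1, and ∫₁^∞ ψ(λ) λ^k dλ = 0 for every positive integer k. -/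
open MeasureTheory

theorem integral_Ioi_eq_integral_one_add_pow_four (f : ℝ → ℝ) :
    ∫ l in Set.Ioi (1 : ℝ), f l =
      ∫ s in Set.Ioi (0 : ℝ), 4 * s ^ 3 * f (1 + s ^ 4) := by
  have hshift : ∫ y in Set.Ioi (0 : ℝ), f (1 + y) = ∫ l in Set.Ioi (1 : ℝ), f l := by
    have h := (measurePreserving_add_left volume (1 : ℝ)).setIntegral_preimage_emb
      (measurableEmbedding_addLeft 1) f (Set.Ioi 1)
    simpa using h
  rw [← hshift, ← integral_comp_rpow_Ioi (fun y => f (1 + y)) (p := 4) (by norm_num)]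
  refine setIntegral_congr_fun measurableSet_Ioi fun s _ => ?_
  have h3 : s ^ ((4 : ℝ) - 1) = s ^ 3 := by
    rw [show (4 : ℝ) - 1 = (3 : ℕ) by norm_num, Real.rpow_natCast]
  have h4 : s ^ (4 : ℝ) = s ^ 4 := by
    rw [show (4 : ℝ) = (4 : ℕ) by norm_num, Real.rpow_natCast]
  simp only [h3, h4, smul_eq_mul]
  norm_num

theorem integrableOn_pow_mul_exp_neg_mul (n : ℕ) {g : ℝ → ℝ} (hg : Continuous g)
    (hb : ∀ s, |g s| ≤ 1) :
    IntegrableOn (fun s => s ^ n * Real.exp (-s) * g s) (Set.Ioi 0) := by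
  have h : IntegrableOn (fun s : ℝ => s ^ n * Real.exp (-s)) (Set.Ioi 0) := by
    have h := Real.GammaIntegral_convergent (s := n + 1) (by positivity)
    simpa [mul_comm] using h
  refine h.mul_bdd (c := 1) hg.aestronglyMeasurable ?_
  exact ae_of_all _ hb

theorem integrableOn_pow_mul_exp_neg_mul_sin (n : ℕ) :
    IntegrableOn (fun s => s ^ n * Real.exp (-s) * Real.sin s) (Set.Ioi 0) :=
  integrableOn_pow_mul_exp_neg_mul n Real.continuous_sin Real.abs_sin_le_one

theorem integrableOn_pow_mul_exp_neg_mul_cos (n : ℕ) :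
    IntegrableOn (fun s => s ^ n * Real.exp (-s) * Real.cos s) (Set.Ioi 0) :=
  integrableOn_pow_mul_exp_neg_mul n Real.continuous_cos Real.abs_cos_le_one

open Filter Topology in
theorem tendsto_pow_mul_exp_neg_mul (n : ℕ) {g : ℝ → ℝ} (hb : ∀ s, |g s| ≤ 1) :
    Tendsto (fun s => s ^ n * Real.exp (-s) * g s) atTop (𝓝 0) := by
  refine squeeze_zero_norm' ?_ (Real.tendsto_pow_mul_exp_neg_atTop_nhds_zero n)
  filter_upwards [eventually_ge_atTop 0] with s hs
  rw [norm_mul, Real.norm_of_nonneg (by positivity)]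
  exact mul_le_of_le_one_right (by positivity) (hb s)

/-- Integration by parts for `s ^ (n + 1) * exp (-s) * sin s`. -/
theorem integral_pow_succ_mul_exp_neg_mul_sin (n : ℕ) :
    ∫ s in Set.Ioi (0 : ℝ), s ^ (n + 1) * Real.exp (-s) * Real.sin s =
      (n + 1) * (∫ s in Set.Ioi (0 : ℝ), s ^ n * Real.exp (-s) * Real.sin s) +
        ∫ s in Set.Ioi (0 : ℝ), s ^ (n + 1) * Real.exp (-s) * Real.cos s := by
  have hS := (integrableOn_pow_mul_exp_neg_mul_sin n).const_mul ((n : ℝ) + 1)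
  have hS' := integrableOn_pow_mul_exp_neg_mul_sin (n + 1)
  have hC' := integrableOn_pow_mul_exp_neg_mul_cos (n + 1)
  have h := integral_Ioi_of_hasDerivAt_of_tendsto' (a := (0 : ℝ))
    (f := fun s => s ^ (n + 1) * Real.exp (-s) * Real.sin s) (m := 0) (fun s _ => by
      have h1 := (((hasDerivAt_pow (n + 1) s).mul (hasDerivAt_neg s).exp).mul
        (Real.hasDerivAt_sin s))
      refine h1.congr_deriv (g' := (((n : ℝ) + 1) * (s ^ n * Real.exp (-s) * Real.sin s) +
        s ^ (n + 1) * Real.exp (-s) * Real.cos s) -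
        s ^ (n + 1) * Real.exp (-s) * Real.sin s) ?_
      simp
      ring) ((hS.add hC').sub hS') (tendsto_pow_mul_exp_neg_mul _ Real.abs_sin_le_one)
  rw [integral_sub' (hS.add hC') hS', integral_add' hS hC', integral_const_mul] at h
  simp at h
  linarith

/-- Integration by parts for `s ^ (n + 1) * exp (-s) * cos s`. -/
theorem integral_pow_succ_mul_exp_neg_mul_cos (n : ℕ) :
    ∫ s in Set.Ioi (0 : ℝ), s ^ (n + 1) * Real.exp (-s) * Real.cos s =
      (n + 1) * (∫ s in Set.Ioi (0 : ℝ), s ^ n * Real.exp (-s) * Real.cos s) -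
        ∫ s in Set.Ioi (0 : ℝ), s ^ (n + 1) * Real.exp (-s) * Real.sin s := by
  have hC := (integrableOn_pow_mul_exp_neg_mul_cos n).const_mul ((n : ℝ) + 1)
  have hS' := integrableOn_pow_mul_exp_neg_mul_sin (n + 1)
  have hC' := integrableOn_pow_mul_exp_neg_mul_cos (n + 1)
  have h := integral_Ioi_of_hasDerivAt_of_tendsto' (a := (0 : ℝ))
    (f := fun s => s ^ (n + 1) * Real.exp (-s) * Real.cos s) (m := 0) (fun s _ => by
      have h1 := (((hasDerivAt_pow (n + 1) s).mul (hasDerivAt_neg s).exp).mul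
        (Real.hasDerivAt_cos s))
      refine h1.congr_deriv (g' := (((n : ℝ) + 1) * (s ^ n * Real.exp (-s) * Real.cos s) -
        s ^ (n + 1) * Real.exp (-s) * Real.sin s) -
        s ^ (n + 1) * Real.exp (-s) * Real.cos s) ?_
      simp
      ring) ((hC.sub hS').sub hC') (tendsto_pow_mul_exp_neg_mul _ Real.abs_cos_le_one)
  rw [integral_sub' (hC.sub hS') hC', integral_sub' hC hS', integral_const_mul] at h
  simp at h
  linarith

theorem integral_exp_neg_mul_sin_eq_integral_exp_neg_mul_cos :
    ∫ s in Set.Ioi (0 : ℝ), s ^ 0 * Real.exp (-s) * Real.sin s =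
      ∫ s in Set.Ioi (0 : ℝ), s ^ 0 * Real.exp (-s) * Real.cos s := by
  have hS := integrableOn_pow_mul_exp_neg_mul_sin 0
  have hC := integrableOn_pow_mul_exp_neg_mul_cos 0
  have h := integral_Ioi_of_hasDerivAt_of_tendsto' (a := (0 : ℝ))
    (f := fun s => s ^ 0 * Real.exp (-s) * Real.sin s) (m := 0) (fun s _ => by
      have h1 := (((hasDerivAt_pow 0 s).mul (hasDerivAt_neg s).exp).mul
        (Real.hasDerivAt_sin s))
      refine h1.congr_deriv (g' := s ^ 0 * Real.exp (-s) * Real.cos s -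
        s ^ 0 * Real.exp (-s) * Real.sin s) ?_
      simp
      ring) (hC.sub hS) (tendsto_pow_mul_exp_neg_mul _ Real.abs_sin_le_one)
  rw [integral_sub' hC hS] at h
  simp only [Real.sin_zero, mul_zero, sub_zero] at h
  linarith

theorem integral_pow_four_mul_add_three_mul_exp_neg_mul_sin (j : ℕ) :
    ∫ s in Set.Ioi (0 : ℝ), s ^ (4 * j + 3) * Real.exp (-s) * Real.sin s = 0 := by
  induction j with
  | zero =>
    have h0 := integral_exp_neg_mul_sin_eq_integral_exp_neg_mul_cos
    have s1 := integral_pow_succ_mul_exp_neg_mul_sin 0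
    have c1 := integral_pow_succ_mul_exp_neg_mul_cos 0
    have s2 := integral_pow_succ_mul_exp_neg_mul_sin 1
    have c2 := integral_pow_succ_mul_exp_neg_mul_cos 1
    have s3 := integral_pow_succ_mul_exp_neg_mul_sin 2
    have c3 := integral_pow_succ_mul_exp_neg_mul_cos 2
    norm_num only [Nat.cast_zero, Nat.cast_one, Nat.cast_ofNat] at *
    linarith
  | succ j ih =>
    have s1 := integral_pow_succ_mul_exp_neg_mul_sin (4 * j + 3)
    have s2 := integral_pow_succ_mul_exp_neg_mul_sin (4 * j + 3 + 1)
    have c2 := integral_pow_succ_mul_exp_neg_mul_cos (4 * j + 3 + 1)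
    have s3 := integral_pow_succ_mul_exp_neg_mul_sin (4 * j + 3 + 1 + 1)
    have c3 := integral_pow_succ_mul_exp_neg_mul_cos (4 * j + 3 + 1 + 1)
    have s4 := integral_pow_succ_mul_exp_neg_mul_sin (4 * j + 3 + 1 + 1 + 1)
    have c4 := integral_pow_succ_mul_exp_neg_mul_cos (4 * j + 3 + 1 + 1 + 1)
    rw [ih, mul_zero, zero_add] at s1
    rw [s1] at s2
    rw [show 4 * (j + 1) + 3 = 4 * j + 3 + 1 + 1 + 1 + 1 by ring]
    have hc2 : ∫ s in Set.Ioi (0 : ℝ),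
        s ^ (4 * j + 3 + 1 + 1) * Real.exp (-s) * Real.cos s = 0 := by linarith
    rw [hc2, mul_zero, zero_sub] at c3
    have hsc : (∫ s in Set.Ioi (0 : ℝ),
        s ^ (4 * j + 3 + 1 + 1 + 1) * Real.exp (-s) * Real.sin s) = -∫ s in Set.Ioi (0 : ℝ),
        s ^ (4 * j + 3 + 1 + 1 + 1) * Real.exp (-s) * Real.cos s := by linarith
    rw [hsc] at s4
    linarith

theorem integral_pow_mul_one_add_pow_four_pow_mul_exp_neg_mul_sin (m j : ℕ) :
    IntegrableOn (fun s : ℝ => s ^ (4 * j + 3) * (1 + s ^ 4) ^ m * Real.exp (-s) * Real.sin s)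
        (Set.Ioi 0) ∧
      ∫ s in Set.Ioi (0 : ℝ),
        s ^ (4 * j + 3) * (1 + s ^ 4) ^ m * Real.exp (-s) * Real.sin s = 0 := by
  induction m generalizing j with
  | zero =>
    simpa using ⟨integrableOn_pow_mul_exp_neg_mul_sin (4 * j + 3),
      integral_pow_four_mul_add_three_mul_exp_neg_mul_sin j⟩
  | succ m ih =>
    have hsplit : (fun s : ℝ =>
        s ^ (4 * j + 3) * (1 + s ^ 4) ^ (m + 1) * Real.exp (-s) * Real.sin s) = fun s : ℝ =>
        s ^ (4 * j + 3) * (1 + s ^ 4) ^ m * Real.exp (-s) * Real.sin s +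
          s ^ (4 * (j + 1) + 3) * (1 + s ^ 4) ^ m * Real.exp (-s) * Real.sin s := by
      funext s
      ring
    rw [hsplit]
    refine ⟨(ih j).1.add (ih (j + 1)).1, ?_⟩
    rw [integral_add (ih j).1 (ih (j + 1)).1, (ih j).2, (ih (j + 1)).2, add_zero]

theorem one_half_le_sin {s : ℝ} (h1 : 1 ≤ s) (h2 : s ≤ 2) : 1 / 2 ≤ Real.sin s := by
  have hpi := Real.pi_gt_three
  have hpi' := Real.pi_lt_d2
  have key : ∀ x : ℝ, 1 ≤ x → x ≤ Real.pi / 2 → 1 / 2 ≤ Real.sin x := fun x hx hx' => by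
    refine le_trans ?_ (Real.mul_le_sin (by linarith) hx')
    rw [div_mul_eq_mul_div, div_le_div_iff₀ (by norm_num) Real.pi_pos]
    linarith
  rcases le_total s (Real.pi / 2) with h | h
  · exact key s h1 h
  · rw [← Real.sin_pi_sub]
    exact key _ (by linarith) (by linarith)

theorem integral_div_one_add_pow_four_mul_exp_neg_mul_sin_pos :
    0 < ∫ s in Set.Ioi (0 : ℝ),
      4 * s ^ 3 * (Real.exp (-s) * Real.sin s / (1 + s ^ 4)) := by
  have hint : IntegrableOn (fun s : ℝ =>
      4 * s ^ 3 * (Real.exp (-s) * Real.sin s / (1 + s ^ 4))) (Set.Ioi 0) := by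
    refine Integrable.mono' ((integrableOn_pow_mul_exp_neg_mul_sin 3).norm.const_mul 4)
      (Continuous.aestronglyMeasurable ?_) ?_
    · exact (by fun_prop : Continuous fun s : ℝ => 4 * s ^ 3).mul
        (Continuous.div (by fun_prop) (by fun_prop) fun s => by positivity)
    · refine ae_of_all _ fun s => ?_
      have h : 4 * s ^ 3 * (Real.exp (-s) * Real.sin s / (1 + s ^ 4)) =
          4 * (s ^ 3 * Real.exp (-s) * Real.sin s) / (1 + s ^ 4) := by ring
      have hs : (0 : ℝ) ≤ s ^ 4 := by positivity
      rw [h, norm_div, norm_mul, Real.norm_of_nonneg (by positivity : (0 : ℝ) ≤ 1 + s ^ 4),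
        Real.norm_of_nonneg (by norm_num : (0 : ℝ) ≤ 4)]
      exact div_le_self (by positivity) (by linarith)
  have hA : IntegrableOn ((Set.Ioc (1 : ℝ) 2).indicator fun _ => 3 / 4 * Real.exp (-2))
      (Set.Ioi 0) :=
    ((integrable_indicator_iff measurableSet_Ioc).2
      (integrableOn_const measure_Ioc_lt_top.ne)).integrableOn
  have hB : IntegrableOn ((Set.Ioi (3 : ℝ)).indicator fun s => 4 / 3 * Real.exp (-s))
      (Set.Ioi 0) :=
    ((integrable_indicator_iff measurableSet_Ioi).2
      ((integrableOn_exp_neg_Ioi 3).const_mul _)).integrableOn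
  have hle := setIntegral_mono_on (hA.sub hB) hint measurableSet_Ioi fun s (hs : 0 < s) => by
    have hden : (0 : ℝ) < 1 + s ^ 4 := by positivity
    have hrw : 4 * s ^ 3 * (Real.exp (-s) * Real.sin s / (1 + s ^ 4)) =
        4 * s ^ 3 / (1 + s ^ 4) * (Real.exp (-s) * Real.sin s) := by ring
    rw [Pi.sub_apply, hrw]
    by_cases h3 : 3 < s
    · rw [Set.indicator_of_notMem (by simp; intro; linarith), Set.indicator_of_mem (s := Set.Ioi 3) h3]
      have hfrac : 4 * s ^ 3 / (1 + s ^ 4) ≤ 4 / 3 := by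
        rw [div_le_div_iff₀ hden (by norm_num)]
        nlinarith [pow_pos hs 3]
      have hfrac0 : 0 ≤ 4 * s ^ 3 / (1 + s ^ 4) := by positivity
      have hE := (Real.exp_pos (-s)).le
      calc 0 - 4 / 3 * Real.exp (-s) ≤ -(4 * s ^ 3 / (1 + s ^ 4) * Real.exp (-s)) := by
            nlinarith
        _ ≤ 4 * s ^ 3 / (1 + s ^ 4) * (Real.exp (-s) * Real.sin s) := by
            nlinarith [Real.neg_one_le_sin s, mul_nonneg hfrac0 hE]
    · rw [Set.indicator_of_notMem (s := Set.Ioi 3) h3, sub_zero]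
      push Not at h3
      by_cases h12 : s ∈ Set.Ioc (1 : ℝ) 2
      · rw [Set.indicator_of_mem h12]
        obtain ⟨h1, h2⟩ := h12
        have hfrac : 3 / 2 ≤ 4 * s ^ 3 / (1 + s ^ 4) := by
          rw [div_le_div_iff₀ (by norm_num) hden]
          nlinarith [mul_nonneg (sub_nonneg.2 (one_le_pow₀ h1.le (n := 3))) (sub_nonneg.2 h2),
            mul_nonneg (sq_nonneg (s - 1)) (by linarith : 0 ≤ s + 2)]
        have hE : Real.exp (-2) ≤ Real.exp (-s) := Real.exp_le_exp.2 (by linarith)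
        calc 3 / 4 * Real.exp (-2) = 3 / 2 * (Real.exp (-2) * (1 / 2)) := by ring
          _ ≤ _ := by
            gcongr
            exact one_half_le_sin h1.le h2
      · rw [Set.indicator_of_notMem h12]
        have := Real.sin_nonneg_of_nonneg_of_le_pi hs.le (by linarith [Real.pi_gt_three])
        positivity
  have he : Real.exp (-2) = Real.exp 1 * Real.exp (-3) := by
    rw [← Real.exp_add]
    norm_num
  have h1 := Real.exp_one_gt_d9
  have h3 := Real.exp_pos (-3)
  have hvol : ∫ _ in Set.Ioc (1 : ℝ) 2, 3 / 4 * Real.exp (-2) = 3 / 4 * Real.exp (-2) := by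
    norm_num
  refine lt_of_lt_of_le ?_ hle
  rw [integral_sub' hA hB, setIntegral_indicator measurableSet_Ioc,
    setIntegral_indicator measurableSet_Ioi,
    Set.inter_eq_right.2 (Set.Ioc_subset_Ioi_self.trans (Set.Ioi_subset_Ioi zero_le_one)),
    Set.inter_eq_right.2 (Set.Ioi_subset_Ioi (by norm_num : (0 : ℝ) ≤ 3)),
    hvol, integral_const_mul, integral_exp_neg_Ioi, he]
  nlinarith

theorem exp_neg_mul_one_add_pow_four_pow_le (N : ℕ) {s : ℝ} (hs : 0 ≤ s) :
    Real.exp (-s) * (1 + s ^ 4) ^ N ≤ (4 * N).factorial * Real.exp 1 := by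
  have h := Real.pow_div_factorial_le_exp (1 + s) (by linarith) (4 * N)
  rw [div_le_iff₀ (by positivity)] at h
  have h4 : 1 + s ^ 4 ≤ (1 + s) ^ 4 := by
    nlinarith [pow_nonneg hs 2, pow_nonneg hs 3]
  calc Real.exp (-s) * (1 + s ^ 4) ^ N ≤ Real.exp (-s) * ((1 + s) ^ 4) ^ N := by gcongr
    _ = Real.exp (-s) * (1 + s) ^ (4 * N) := by rw [pow_mul]
    _ ≤ Real.exp (-s) * (Real.exp (1 + s) * (4 * N).factorial) := by gcongr
    _ = (4 * N).factorial * (Real.exp (-s) * Real.exp (1 + s)) := by ring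
    _ = (4 * N).factorial * Real.exp 1 := by
      rw [← Real.exp_add]
      ring_nf

/-- The unnormalised Stein kernel. -/
noncomputable def steinKernel (l : ℝ) : ℝ :=
  Real.exp (-(l - 1) ^ (1 / 4 : ℝ)) * Real.sin ((l - 1) ^ (1 / 4 : ℝ)) / l

theorem steinKernel_one_add_pow_four {s : ℝ} (hs : 0 ≤ s) :
    steinKernel (1 + s ^ 4) = Real.exp (-s) * Real.sin s / (1 + s ^ 4) := by
  have h : (s ^ 4) ^ (1 / 4 : ℝ) = s := by
    rw [← Real.rpow_natCast, ← Real.rpow_mul hs]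
    norm_num
  simp only [steinKernel, add_sub_cancel_left, h]

theorem continuousOn_steinKernel : ContinuousOn steinKernel (Set.Ici 1) := by
  have h : Continuous fun l : ℝ => (l - 1) ^ (1 / 4 : ℝ) :=
    (continuous_id.sub continuous_const).rpow_const fun _ => Or.inr (by norm_num)
  refine ContinuousOn.div (Continuous.continuousOn ?_) continuousOn_id
    fun l (hl : 1 ≤ l) => ne_of_gt (zero_lt_one.trans_le hl)
  exact (Real.continuous_exp.comp h.neg).mul (Real.continuous_sin.comp h)

theorem abs_steinKernel_le (N : ℕ) {l : ℝ} (hl : 1 ≤ l) :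
    |steinKernel l| ≤ (4 * N).factorial * Real.exp 1 * l ^ (-(N : ℝ)) := by
  obtain ⟨s, hs, rfl⟩ : ∃ s : ℝ, 0 ≤ s ∧ l = 1 + s ^ 4 := by
    refine ⟨(l - 1) ^ (1 / 4 : ℝ), Real.rpow_nonneg (by linarith) _, ?_⟩
    rw [← Real.rpow_natCast, ← Real.rpow_mul (by linarith)]
    norm_num
  have hpos : (0 : ℝ) < 1 + s ^ 4 := by positivity
  rw [steinKernel_one_add_pow_four hs, Real.rpow_neg hpos.le, Real.rpow_natCast,
    ← div_eq_mul_inv, le_div_iff₀ (by positivity)]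
  refine le_trans ?_ (exp_neg_mul_one_add_pow_four_pow_le N hs)
  gcongr
  rw [abs_div, abs_mul, abs_of_pos hpos, Real.abs_exp]
  exact (div_le_self (by positivity) hl).trans
    (mul_le_of_le_one_right (Real.exp_pos _).le (Real.abs_sin_le_one s))

theorem integral_steinKernel_pos : 0 < ∫ l in Set.Ioi (1 : ℝ), steinKernel l := by
  rw [integral_Ioi_eq_integral_one_add_pow_four]
  refine integral_div_one_add_pow_four_mul_exp_neg_mul_sin_pos.trans_eq
    (setIntegral_congr_fun measurableSet_Ioi fun s (hs : 0 < s) => ?_)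
  simp only [steinKernel_one_add_pow_four hs.le]

theorem integral_steinKernel_mul_pow_succ (m : ℕ) :
    ∫ l in Set.Ioi (1 : ℝ), steinKernel l * l ^ (m + 1) = 0 := by
  have h := congrArg (4 * ·) (integral_pow_mul_one_add_pow_four_pow_mul_exp_neg_mul_sin m 0).2
  simp only [← integral_const_mul, mul_zero] at h
  rw [integral_Ioi_eq_integral_one_add_pow_four]
  refine Eq.trans (setIntegral_congr_fun measurableSet_Ioi fun s (hs : 0 < s) => ?_) h
  have hpos : (0 : ℝ) < 1 + s ^ 4 := by positivity
  simp only [steinKernel_one_add_pow_four hs.le]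
  field_simp
  ring

/-- There exists a continuous `ψ : [1,∞) → ℝ` with `ψ(λ) = O(λ^{−N})` as `λ → ∞` for
every `N`, `∫₁^∞ ψ(λ) dλ = 1`, and `∫₁^∞ ψ(λ) λ^k dλ = 0` for every positive integer `k`. -/
theorem stmt_7 :
    ∃ ψ : ℝ → ℝ, ContinuousOn ψ (Set.Ici 1) ∧
      (∀ N : ℕ, ∃ C : ℝ, ∀ l : ℝ, 1 ≤ l → |ψ l| ≤ C * l ^ (-(N : ℝ))) ∧
      (∫ l in Set.Ioi (1 : ℝ), ψ l) = 1 ∧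
      ∀ k : ℕ, 1 ≤ k → (∫ l in Set.Ioi (1 : ℝ), ψ l * l ^ k) = 0 := by
  have hc := integral_steinKernel_pos
  set c := ∫ l in Set.Ioi (1 : ℝ), steinKernel l
  refine ⟨fun l => c⁻¹ * steinKernel l, continuousOn_const.mul continuousOn_steinKernel,
    fun N => ⟨c⁻¹ * ((4 * N).factorial * Real.exp 1), fun l hl => ?_⟩, ?_, fun k hk => ?_⟩
  · rw [abs_mul, abs_of_pos (inv_pos.2 hc), mul_assoc]
    gcongr
    exact abs_steinKernel_le N hl
  · rw [integral_const_mul]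
    exact inv_mul_cancel₀ hc.ne'
  · obtain ⟨m, rfl⟩ := Nat.exists_eq_add_of_le' hk
    simp only [mul_assoc]
    rw [integral_const_mul, integral_steinKernel_mul_pow_succ, mul_zero]
end
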